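/- For any signature σ, any models M₁, M₂ based on descriptive frames, and any points x₁, x₂: M₁,x₁ ≡_σ M₂,x₂ if and only if M₁,x₁ ∼_σ M₂,x₂. The implication from M₁,x₁ ∼_σ M₂,x₂ to M₁,x₁ ≡_σ M₂,x₂ holds for models based on arbitrary general frames. -/

import Mathlib

/-! ## Modal formulas -/

inductive MF : Type
  | var : ℕ → MF
  | top : MF
  | bot : MF
  | neg : MF → MF
  | and : MF → MF → MF
  | dia : MF → MF
deriving DecidableEq

namespace MF

def or (φ ψ : MF) : MF := .neg (.and (.neg φ) (.neg ψ))
def imp (φ ψ : MF) : MF := MF.or (.neg φ) ψ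
def box (φ : MF) : MF := .neg (.dia (.neg φ))
def diaPlus (φ : MF) : MF := MF.or φ (.dia φ)
def boxPlus (φ : MF) : MF := .and φ (box φ)

/-- the propositional variables occurring in a formula -/
def vars : MF → Finset ℕ
  | .var p => {p}
  | .top => ∅
  | .bot => ∅
  | .neg φ => vars φ
  | .and φ ψ => vars φ ∪ vars ψ
  | .dia φ => vars φ

/-- the signature of a formula -/
def sig (φ : MF) : Set ℕ := ↑(vars φ)

/-- subformulas -/
def subs : MF → Finset MF
  | .var p => {.var p}
  | .top => {.top}
  | .bot => {.bot}
  | .neg φ => insert (.neg φ) (subs φ)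
  | .and φ ψ => insert (.and φ ψ) (subs φ ∪ subs ψ)
  | .dia φ => insert (.dia φ) (subs φ)

/-- `|φ|`: the number of subformulas of `φ` together with their negations -/
def size (φ : MF) : ℕ := ((subs φ) ∪ (subs φ).image MF.neg).card

/-- uniform substitution -/
def substVar (s : ℕ → MF) : MF → MF
  | .var p => s p
  | .top => .top
  | .bot => .bot
  | .neg φ => .neg (substVar s φ)
  | .and φ ψ => .and (substVar s φ) (substVar s ψ)
  | .dia φ => .dia (substVar s φ)

end MF

/-- a Boolean evaluation of modal formulas (treating `◇`-formulas and variables as atoms) -/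
def BoolEval (f : MF → Prop) : Prop :=
  f .top ∧ ¬ f .bot ∧ (∀ φ, f (.neg φ) ↔ ¬ f φ) ∧ (∀ φ ψ, f (.and φ ψ) ↔ (f φ ∧ f ψ))

/-- Boolean tautologies in the modal language -/
def MF.Tautology (φ : MF) : Prop := ∀ f : MF → Prop, BoolEval f → f φ

/-- normal modal logics -/
structure IsNormalLogic (L : Set MF) : Prop where
  taut : ∀ φ, φ.Tautology → φ ∈ L
  axK : MF.imp (MF.box (MF.imp (.var 0) (.var 1)))
          (MF.imp (MF.box (.var 0)) (MF.box (.var 1))) ∈ L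
  mp : ∀ φ ψ, φ ∈ L → MF.imp φ ψ ∈ L → ψ ∈ L
  subst : ∀ φ s, φ ∈ L → MF.substVar s φ ∈ L
  nec : ∀ φ, φ ∈ L → MF.box φ ∈ L

/-- the smallest normal modal logic containing `Γ` -/
def NormClosure (Γ : Set MF) : Set MF :=
  {φ | ∀ L : Set MF, IsNormalLogic L → Γ ⊆ L → φ ∈ L}

def ax4 : MF := MF.imp (MF.box (.var 0)) (MF.box (MF.box (.var 0)))
def ax43 : MF := MF.or (MF.box (MF.imp (MF.boxPlus (.var 0)) (.var 1)))
                       (MF.box (MF.imp (MF.boxPlus (.var 1)) (.var 0)))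
def axGL : MF := MF.imp (MF.box (MF.imp (MF.box (.var 0)) (.var 0))) (MF.box (.var 0))

def K4 : Set MF := NormClosure {ax4}
def K43 : Set MF := NormClosure {ax4, ax43}
def GL3 : Set MF := NormClosure {ax4, ax43, axGL}

/-! ## General frames and models -/

/-- a (general) frame: a relation together with a collection of "internal" sets -/
structure KFrame (W : Type) where
  R : W → W → Prop
  P : Set (Set W)

namespace KFrame

variable {W : Type}

def dia (F : KFrame W) (X : Set W) : Set W := {x | ∃ y ∈ X, F.R x y}

/-- the conditions making `F` a general frame -/
def IsGeneral (F : KFrame W) : Prop :=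
  Nonempty W ∧ ∅ ∈ F.P ∧ Set.univ ∈ F.P ∧
    (∀ X ∈ F.P, ∀ Y ∈ F.P, X ∩ Y ∈ F.P) ∧
    (∀ X ∈ F.P, Xᶜ ∈ F.P) ∧ (∀ X ∈ F.P, F.dia X ∈ F.P)

/-- differentiated, tight and compact -/
def Descriptive (F : KFrame W) : Prop :=
  (∀ x y : W, (∀ X ∈ F.P, x ∈ X ↔ y ∈ X) → x = y) ∧
  (∀ x y : W, F.R x y ↔ ∀ X ∈ F.P, y ∈ X → x ∈ F.dia X) ∧
  (∀ 𝒳 : Set (Set W), 𝒳 ⊆ F.P →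
    (∀ 𝒴 : Set (Set W), 𝒴 ⊆ 𝒳 → 𝒴.Finite → (⋂₀ 𝒴).Nonempty) → (⋂₀ 𝒳).Nonempty)

/-- `x` is a root of `F` (every point is reachable from `x` via the reflexive closure) -/
def Rooted (F : KFrame W) (x : W) : Prop := ∀ y : W, x = y ∨ F.R x y

/-- the strict order on clusters: `C(x) <_R C(y)` -/
def clLT (F : KFrame W) (x y : W) : Prop := F.R x y ∧ ¬ F.R y x

/-- the cluster of a point -/
def cluster (F : KFrame W) (x : W) : Set W := insert x {y | F.R x y ∧ F.R y x}

def clLE (F : KFrame W) (x y : W) : Prop := y ∈ F.cluster x ∨ F.clLT x y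

/-- the closed interval of clusters `[C(x), C(y)]` -/
def interval (F : KFrame W) (x y : W) : Set W := {z | F.clLE x z ∧ F.clLE z y}

/-- `C(x)` is the final cluster -/
def FinalCl (F : KFrame W) (x : W) : Prop := ∀ y, ¬ F.clLT x y

/-- `C(y)` is an immediate successor of `C(x)` -/
def ImmSucc (F : KFrame W) (x y : W) : Prop :=
  F.clLT x y ∧ ¬ ∃ z, F.clLT x z ∧ F.clLT z y

/-- `C(x)` is a limit cluster -/
def LimitCl (F : KFrame W) (x : W) : Prop := ¬ F.FinalCl x ∧ ¬ ∃ y, F.ImmSucc x y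

/-- `C(x)` is a degenerate cluster -/
def DegenerateCl (F : KFrame W) (x : W) : Prop := ¬ F.R x x

end KFrame

/-- the closure of a family of sets under `∩`, complement and `◇` -/
inductive genBy {W : Type} (R : W → W → Prop) (G : Set (Set W)) : Set W → Prop
  | basic {X : Set W} : X ∈ G → genBy R G X
  | empty : genBy R G ∅
  | univ : genBy R G Set.univ
  | inter {X Y : Set W} : genBy R G X → genBy R G Y → genBy R G (X ∩ Y)
  | compl {X : Set W} : genBy R G X → genBy R G Xᶜ
  | dia {X : Set W} : genBy R G X → genBy R G {x | ∃ y ∈ X, R x y}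

def KFrame.GeneratedBy {W : Type} (F : KFrame W) (G : Set (Set W)) : Prop :=
  F.P = {X | genBy F.R G X}

def KFrame.FinGenerated {W : Type} (F : KFrame W) : Prop :=
  ∃ G : Set (Set W), G.Finite ∧ F.GeneratedBy G

def KFrame.NGenerated {W : Type} (F : KFrame W) (n : ℕ) : Prop :=
  ∃ G : Set (Set W), G.Finite ∧ G.ncard = n ∧ F.GeneratedBy G

/-- a model: a frame with a valuation -/
structure KModel (W : Type) where
  F : KFrame W
  v : ℕ → Set W

namespace KModel

variable {W : Type}

/-- the frame is a general frame and all values of the valuation are internal -/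
def IsModel (M : KModel W) : Prop := M.F.IsGeneral ∧ ∀ p, M.v p ∈ M.F.P

/-- truth at a point -/
def sat (M : KModel W) : W → MF → Prop
  | x, .var p => x ∈ M.v p
  | _, .top => True
  | _, .bot => False
  | x, .neg φ => ¬ sat M x φ
  | x, .and φ ψ => sat M x φ ∧ sat M x ψ
  | x, .dia φ => ∃ y, M.F.R x y ∧ sat M y φ

/-- a set is definable in `M` -/
def Definable (M : KModel W) (X : Set W) : Prop := ∃ φ : MF, X = {x | M.sat x φ}

/-- every internal set is definable in `M` -/
def MGenerated (M : KModel W) : Prop := ∀ X ∈ M.F.P, M.Definable X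

/-- finitely `M`-generated -/
def FinMGenerated (M : KModel W) : Prop := M.MGenerated ∧ M.F.FinGenerated

/-- the σ-type of a point: all σ-formulas true at it -/
def stype (M : KModel W) (σ : Set ℕ) (x : W) : Set MF := {φ | φ.sig ⊆ σ ∧ M.sat x φ}

/-- `x` is `Γ`-maximal in `M` -/
def MaxFor (M : KModel W) (Γ : Set MF) (x : W) : Prop :=
  (∀ γ ∈ Γ, M.sat x γ) ∧ ∀ y, M.F.R x y → (∀ γ ∈ Γ, M.sat y γ) → M.F.R y x

/-- the cluster `C(x)` is `μ`-maximal in `M` -/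
def ClMuMax (M : KModel W) (μ : MF) (x : W) : Prop := ∃ z ∈ M.F.cluster x, M.MaxFor {μ} z

/-- the cluster `C(x)` is maximal in `M` -/
def ClMax (M : KModel W) (x : W) : Prop := ∃ μ : MF, M.ClMuMax μ x

/-- the cluster `C(x)` is σ-maximal in `M` -/
def ClSigMax (M : KModel W) (σ : Set ℕ) (x : W) : Prop :=
  ∃ μ : MF, μ.sig ⊆ σ ∧ M.ClMuMax μ x

/-- the cluster `C(x)` is definable in `M` -/
def ClDefinable (M : KModel W) (x : W) : Prop := M.Definable (M.F.cluster x)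

/-- `◇ t^σ_M(x) ⊆ t^σ_M(y)` -/
def diaSubset (M : KModel W) (σ : Set ℕ) (x y : W) : Prop :=
  ∀ φ ∈ M.stype σ x, MF.dia φ ∈ M.stype σ y

/-- the σ-block of a point -/
def sblockOf (M : KModel W) (σ : Set ℕ) (x : W) : Set W :=
  {y | (M.diaSubset σ x x ∧ M.diaSubset σ y x ∧ M.diaSubset σ x y) ∨
       (¬ M.diaSubset σ x x ∧ y = x)}

/-- a σ-block in `M` -/
def IsSBlock (M : KModel W) (σ : Set ℕ) (b : Set W) : Prop := ∃ x, b = M.sblockOf σ x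

/-- a degenerate σ-block in `M` -/
def DegenSBlock (M : KModel W) (σ : Set ℕ) (b : Set W) : Prop :=
  ∃ x, b = M.sblockOf σ x ∧ ¬ M.diaSubset σ x x

end KModel

/-- validity of a formula on a frame -/
def KFrame.Valid {W : Type} (F : KFrame W) (φ : MF) : Prop :=
  ∀ v : ℕ → Set W, (∀ p, v p ∈ F.P) → ∀ x, (KModel.mk F v).sat x φ

/-- `F` is a frame for the logic `L` -/
def KFrame.IsFrameFor {W : Type} (F : KFrame W) (L : Set MF) : Prop :=
  ∀ φ ∈ L, F.Valid φ

/-! ## Bisimulations -/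

def IsBisim {W₁ W₂ : Type} (σ : Set ℕ) (M₁ : KModel W₁) (M₂ : KModel W₂)
    (β : W₁ → W₂ → Prop) : Prop :=
  ∀ x₁ x₂, β x₁ x₂ →
    (∀ p ∈ σ, x₁ ∈ M₁.v p ↔ x₂ ∈ M₂.v p) ∧
    (∀ y₁, M₁.F.R x₁ y₁ → ∃ y₂, M₂.F.R x₂ y₂ ∧ β y₁ y₂) ∧
    (∀ y₂, M₂.F.R x₂ y₂ → ∃ y₁, M₁.F.R x₁ y₁ ∧ β y₁ y₂)

def Bisimilar {W₁ W₂ : Type} (σ : Set ℕ) (M₁ : KModel W₁) (x₁ : W₁)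
    (M₂ : KModel W₂) (x₂ : W₂) : Prop :=
  ∃ β, IsBisim σ M₁ M₂ β ∧ β x₁ x₂

/-- the two points satisfy the same variables of `σ` -/
def SigAgree {W₁ W₂ : Type} (σ : Set ℕ) (M₁ : KModel W₁) (x₁ : W₁)
    (M₂ : KModel W₂) (x₂ : W₂) : Prop :=
  ∀ p ∈ σ, x₁ ∈ M₁.v p ↔ x₂ ∈ M₂.v p

/-- the two points have the same σ-type -/
def TypeEquiv {W₁ W₂ : Type} (σ : Set ℕ) (M₁ : KModel W₁) (x₁ : W₁)
    (M₂ : KModel W₂) (x₂ : W₂) : Prop :=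
  ∀ φ : MF, φ.sig ⊆ σ → (M₁.sat x₁ φ ↔ M₂.sat x₂ φ)

/-! ## Interpolants -/

def IsInterpolant (L : Set MF) (φ₁ φ₂ ι : MF) : Prop :=
  ι.sig ⊆ φ₁.sig ∩ φ₂.sig ∧ MF.imp φ₁ ι ∈ L ∧ MF.imp ι φ₂ ∈ L

def NoInterpolant (L : Set MF) (φ₁ φ₂ : MF) : Prop := ¬ ∃ ι, IsInterpolant L φ₁ φ₂ ι

def HasCIP (L : Set MF) : Prop :=
  ∀ φ₁ φ₂ : MF, MF.imp φ₁ φ₂ ∈ L → ∃ ι, IsInterpolant L φ₁ φ₂ ι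

/-- `k(φ₁,φ₂) = 3 + 3·max(|φ₁|,|φ₂|)` -/
def kBound (φ₁ φ₂ : MF) : ℕ := 3 + 3 * max φ₁.size φ₂.size

/-- the conjunction of a finite list of formulas -/
def conjList : List MF → MF
  | [] => .top
  | φ :: l => .and φ (conjList l)

/-! ## d-persistence and cofinal subframe logics -/

def DPersistent (L : Set MF) : Prop :=
  ∀ (W : Type) (F : KFrame W), F.IsGeneral → F.Descriptive → F.IsFrameFor L →
    KFrame.IsFrameFor ⟨F.R, (Set.univ : Set (Set W))⟩ L

def CofinalSet {W : Type} (F : KFrame W) (S : Set W) : Prop :=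
  ∀ x ∈ S, ∀ y, F.R x y → y ∈ S ∨ ∃ z ∈ S, F.R y z

/-- the subframe of `F` with underlying set `S` and internal sets `Q` -/
def subframeOn {W : Type} (F : KFrame W) (S : Set W) (Q : Set (Set W)) : KFrame S :=
  ⟨fun a b => F.R a.1 b.1, {T | ∃ X ∈ Q, T = (Subtype.val ⁻¹' X : Set S)}⟩

/-- the class of general frames of `L` is closed under cofinal subframes -/
def CofinalSubframeLogic (L : Set MF) : Prop :=
  ∀ (W : Type) (F : KFrame W) (S : Set W) (Q : Set (Set W)),
    F.IsGeneral → F.IsFrameFor L → Q ⊆ F.P → (∀ X ∈ Q, X ⊆ S) →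
    (subframeOn F S Q).IsGeneral → CofinalSet F S →
    (subframeOn F S Q).IsFrameFor L

/-- the subframe of `F` generated by a point `x` -/
def KFrame.genSub {W : Type} (F : KFrame W) (x : W) :
    KFrame {y : W // x = y ∨ F.R x y} :=
  ⟨fun a b => F.R a.1 b.1, {S | ∃ X ∈ F.P, S = Subtype.val ⁻¹' X}⟩

namespace KModel

variable {W : Type}

/-- truth sets of formulas are internal -/
theorem IsModel.setOf_sat_mem {M : KModel W} (hM : M.IsModel) (φ : MF) :
    {x | M.sat x φ} ∈ M.F.P := by
  obtain ⟨⟨-, hempty, huniv, hinter, hcompl, hdia⟩, hv⟩ := hM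
  induction φ with
  | var p => exact hv p
  | top => simpa only [sat, Set.ofPred_true] using huniv
  | bot => simpa only [sat, Set.ofPred_false] using hempty
  | neg φ ih => exact hcompl _ ih
  | and φ ψ ihφ ihψ => exact hinter _ ihφ _ ihψ
  | dia φ ih => simpa only [sat, KFrame.dia, Set.mem_ofPred_eq, and_comm] using hdia _ ih

end KModel

section

variable {W₁ W₂ : Type} {σ : Set ℕ} {M₁ : KModel W₁} {M₂ : KModel W₂}

theorem TypeEquiv.symm {x₁ : W₁} {x₂ : W₂} (h : TypeEquiv σ M₁ x₁ M₂ x₂) :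
    TypeEquiv σ M₂ x₂ M₁ x₁ :=
  fun φ hφ => (h φ hφ).symm

theorem IsBisim.typeEquiv {β : W₁ → W₂ → Prop} (hβ : IsBisim σ M₁ M₂ β)
    {x₁ : W₁} {x₂ : W₂} (hx : β x₁ x₂) : TypeEquiv σ M₁ x₁ M₂ x₂ := by
  intro φ hφ
  induction φ generalizing x₁ x₂ with
  | var p => exact (hβ x₁ x₂ hx).1 p (hφ (by simp [MF.sig, MF.vars]))
  | top => exact Iff.rfl
  | bot => exact Iff.rfl
  | neg φ ih => exact not_congr (ih hx hφ)
  | and φ ψ ihφ ihψ =>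
    simp only [MF.sig, MF.vars, Finset.coe_union, Set.union_subset_iff] at hφ
    exact and_congr (ihφ hx hφ.1) (ihψ hx hφ.2)
  | dia φ ih =>
    obtain ⟨-, hforth, hback⟩ := hβ x₁ x₂ hx
    constructor
    · rintro ⟨y₁, hy₁, hsat⟩
      obtain ⟨y₂, hy₂, hy⟩ := hforth y₁ hy₁
      exact ⟨y₂, hy₂, (ih hy hφ).1 hsat⟩
    · rintro ⟨y₂, hy₂, hsat⟩
      obtain ⟨y₁, hy₁, hy⟩ := hback y₂ hy₂
      exact ⟨y₁, hy₁, (ih hy hφ).2 hsat⟩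

theorem TypeEquiv.exists_succ {x₁ y₁ : W₁} {x₂ : W₂} (h : TypeEquiv σ M₁ x₁ M₂ x₂)
    (hM₂ : M₂.IsModel) (hD₂ : M₂.F.Descriptive) (hy₁ : M₁.F.R x₁ y₁) :
    ∃ y₂, M₂.F.R x₂ y₂ ∧ TypeEquiv σ M₁ y₁ M₂ y₂ := by
  obtain ⟨-, htight, hcompact⟩ := hD₂
  let Forced (X : Set W₂) : Prop :=
    ∃ φ : MF, φ.sig ⊆ σ ∧ M₁.sat y₁ φ ∧ ∀ z, M₂.F.R x₂ z → M₂.sat z φ → z ∈ X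
  have hfinite (𝒴 : Set (Set W₂)) (hfin : 𝒴.Finite) (h𝒴 : ∀ X ∈ 𝒴, Forced X) :
      Forced (⋂₀ 𝒴) := by
    induction 𝒴, hfin using Set.Finite.induction_on with
    | empty => exact ⟨.top, by simp [MF.sig, MF.vars], trivial, by simp⟩
    | @insert X 𝒴 _ _ ih =>
      obtain ⟨φ, hφ, hφy, hφX⟩ := h𝒴 X (Set.mem_insert _ _)
      obtain ⟨ψ, hψ, hψy, hψX⟩ := ih fun Y hY => h𝒴 Y (Set.mem_insert_of_mem _ hY)
      refine ⟨.and φ ψ, ?_, ⟨hφy, hψy⟩, fun z hz hsat => ?_⟩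
      · simpa [MF.sig, MF.vars] using ⟨hφ, hψ⟩
      · rw [Set.sInter_insert]
        exact ⟨hφX z hz hsat.1, hψX z hz hsat.2⟩
  obtain ⟨y₂, hy₂⟩ := hcompact {X | X ∈ M₂.F.P ∧ Forced X} (fun X hX => hX.1)
    fun 𝒴 h𝒴 hfin => by
      obtain ⟨φ, hφ, hφy, hsub⟩ := hfinite 𝒴 hfin fun X hX => (h𝒴 hX).2
      obtain ⟨z, hz, hφz⟩ := (h (.dia φ) hφ).1 ⟨y₁, hy₁, hφy⟩
      exact ⟨z, hsub z hz hφz⟩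
  have htype (φ : MF) (hφ : φ.sig ⊆ σ) (hφy : M₁.sat y₁ φ) : M₂.sat y₂ φ :=
    hy₂ {z | M₂.sat z φ} ⟨hM₂.setOf_sat_mem φ, φ, hφ, hφy, fun _ _ hz => hz⟩
  refine ⟨y₂, (htight x₂ y₂).2 fun X hX hyX => ?_, fun φ hφ =>
    ⟨htype φ hφ, fun hsat => by_contra fun hn => htype (.neg φ) hφ hn hsat⟩⟩
  by_contra hx
  exact hy₂ Xᶜ ⟨hM₂.1.2.2.2.2.1 X hX, .top, by simp [MF.sig, MF.vars], trivial,
    fun z hz _ hzX => hx ⟨z, hzX, hz⟩⟩ hyX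

theorem isBisim_typeEquiv (hM₁ : M₁.IsModel) (hM₂ : M₂.IsModel)
    (hD₁ : M₁.F.Descriptive) (hD₂ : M₂.F.Descriptive) :
    IsBisim σ M₁ M₂ fun x₁ x₂ => TypeEquiv σ M₁ x₁ M₂ x₂ := by
  refine fun x₁ x₂ h => ⟨fun p hp => h (.var p) (by simpa [MF.sig, MF.vars] using hp),
    fun y₁ hy₁ => h.exists_succ hM₂ hD₂ hy₁, fun y₂ hy₂ => ?_⟩
  obtain ⟨y₁, hy₁, hy⟩ := h.symm.exists_succ hM₁ hD₁ hy₂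
  exact ⟨y₁, hy₁, hy.symm⟩

end

/-- For models based on descriptive frames, having the same `σ`-type
coincides with being `σ`-bisimilar; the right-to-left implication holds for models
based on arbitrary general frames. -/
theorem bisimulation_lemma :
    (∀ (σ : Set ℕ) (W₁ W₂ : Type) (M₁ : KModel W₁) (M₂ : KModel W₂),
      M₁.IsModel → M₂.IsModel → M₁.F.Descriptive → M₂.F.Descriptive →
      ∀ (x₁ : W₁) (x₂ : W₂),
        (TypeEquiv σ M₁ x₁ M₂ x₂ ↔ Bisimilar σ M₁ x₁ M₂ x₂)) ∧
    (∀ (σ : Set ℕ) (W₁ W₂ : Type) (M₁ : KModel W₁) (M₂ : KModel W₂),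
      M₁.IsModel → M₂.IsModel →
      ∀ (x₁ : W₁) (x₂ : W₂),
        Bisimilar σ M₁ x₁ M₂ x₂ → TypeEquiv σ M₁ x₁ M₂ x₂) := by
  refine ⟨fun σ W₁ W₂ M₁ M₂ hM₁ hM₂ hD₁ hD₂ x₁ x₂ => ⟨fun h => ?_, ?_⟩, ?_⟩
  · exact ⟨_, isBisim_typeEquiv hM₁ hM₂ hD₁ hD₂, h⟩
  · rintro ⟨β, hβ, hx⟩
    exact hβ.typeEquiv hx
  · rintro σ W₁ W₂ M₁ M₂ - - x₁ x₂ ⟨β, hβ, hx⟩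
    exact hβ.typeEquiv hx
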